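/- Let S ⊆ ℝⁿ with 0 ∈ S, let (r_α)_{α∈ℕⁿ} be real numbers, and let Φ = Σ_{α∈ℕⁿ} r_α D^α be the corresponding differential operator with constant coefficients (the sum applied to any polynomial is finite). If Φ is an S-nonnegativity preserver, then the sequence (α!·r_α)_{α∈ℕⁿ} is a moment sequence of the closure of S: there exists a nonnegative Borel measure μ on the closure of S such that every polynomial is μ-integrable and ∫ X^α dμ = α!·r_α for all α ∈ ℕⁿ. -/

import Mathlib

open MvPolynomial MeasureTheory

/-- The differential operator `D^α = ∂₁^{α₁} ⋯ ∂ₙ^{αₙ}` on `ℝ[X₁,…,Xₙ]`. -/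
noncomputable def Dop (n : ℕ) (α : Fin n → ℕ) :
    Module.End ℝ (MvPolynomial (Fin n) ℝ) :=
  (List.ofFn (fun i : Fin n =>
    ((MvPolynomial.pderiv i).toLinearMap : Module.End ℝ (MvPolynomial (Fin n) ℝ)) ^ (α i))).prod

section Haviland

open Filter Topology CompactlySupported

variable {σ : Type*}

/-- A positive functional on polynomials extends, compatibly with domination on `S`, to a positive
functional on compactly supported continuous functions. -/
theorem exists_positiveLinearMap_le_of_nonneg (S : Set (σ → ℝ)) (L : MvPolynomial σ ℝ →ₗ[ℝ] ℝ)
    (hL : ∀ p, (∀ x ∈ S, 0 ≤ eval x p) → 0 ≤ L p) :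
    ∃ Λ : C_c(σ → ℝ, ℝ) →ₚ[ℝ] ℝ, ∀ (p : MvPolynomial σ ℝ) (f : C_c(σ → ℝ, ℝ)),
      (∀ x ∈ S, f x ≤ eval x p) → Λ f ≤ L p := by
  let s : PointedCone ℝ (MvPolynomial σ ℝ × C_c(σ → ℝ, ℝ)) :=
    { carrier := {q | ∀ x ∈ S, 0 ≤ eval x q.1 + q.2 x}
      zero_mem' := by simp
      add_mem' := by
        intro a b ha hb x hx
        have h₁ := ha x hx
        have h₂ := hb x hx
        simp only [Prod.fst_add, Prod.snd_add, map_add, CompactlySupportedContinuousMap.coe_add,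
          Pi.add_apply]
        linarith
      smul_mem' := by
        rintro ⟨c, hc⟩ a ha x hx
        have h := mul_nonneg hc (ha x hx)
        simpa [mul_add, smul_eval, Nonneg.mk_smul] using h }
  let f : (MvPolynomial σ ℝ × C_c(σ → ℝ, ℝ)) →ₗ.[ℝ] ℝ :=
    { domain := LinearMap.ker (LinearMap.snd ℝ (MvPolynomial σ ℝ) C_c(σ → ℝ, ℝ))
      toFun := (L.comp (LinearMap.fst ℝ _ _)).comp (Submodule.subtype _) }
  have hf : ∀ x : f.domain, f x = L (x : MvPolynomial σ ℝ × C_c(σ → ℝ, ℝ)).1 := fun _ => rfl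
  have hdom : ∀ x : f.domain, (x : MvPolynomial σ ℝ × C_c(σ → ℝ, ℝ)).2 = 0 := fun x => x.2
  obtain ⟨g, hg, hgs⟩ := riesz_extension s f
    (by
      intro x hx
      refine hL _ fun y hy => ?_
      have h := hx y hy
      simpa [hdom x] using h)
    (by
      rintro ⟨q, φ⟩
      obtain ⟨c, hc⟩ := φ.hasCompactSupport.exists_bound_of_continuous φ.continuous
      refine ⟨⟨(C c - q, 0), rfl⟩, fun x _ => ?_⟩
      have h := neg_le_of_abs_le (hc x)
      simp only [Prod.fst_add, Prod.snd_add, zero_add, sub_add_cancel, eval_C]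
      linarith)
  have hgL : ∀ p, g (p, 0) = L p := fun p => hg ⟨(p, 0), rfl⟩
  refine ⟨PositiveLinearMap.mk₀ (g.comp (LinearMap.inr ℝ _ _)) ?_, fun p φ h => ?_⟩
  · intro φ hφ
    refine hgs _ fun x _ => ?_
    simpa using hφ x
  · have h' := hgs (p, -φ) fun x hx => by simpa using h x hx
    have e : ((p, -φ) : MvPolynomial σ ℝ × C_c(σ → ℝ, ℝ)) = (p, 0) - (0, φ) := by simp
    rw [e, map_sub, hgL] at h'
    exact sub_nonneg.1 h'

/-- A polynomial as a continuous function. -/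
noncomputable def evalContinuousMap (p : MvPolynomial σ ℝ) : C(σ → ℝ, ℝ) :=
  ⟨fun x => eval x p, MvPolynomial.continuous_eval p⟩

theorem evalContinuousMap_apply (p : MvPolynomial σ ℝ) (x : σ → ℝ) :
    evalContinuousMap p x = eval x p := rfl

variable [Fintype σ]

/-- The function `g` multiplied by the cutoff `max 0 (1 - ∑ i, xᵢ ^ 2 / (k + 1))`. -/
noncomputable def cutoffMul (g : C(σ → ℝ, ℝ)) (k : ℕ) : C_c(σ → ℝ, ℝ) where
  toFun x := max 0 (1 - (∑ i, x i ^ 2) / (k + 1)) * g x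
  continuous_toFun := by fun_prop
  hasCompactSupport' := by
    refine HasCompactSupport.intro (isCompact_closedBall (0 : σ → ℝ) (k + 1)) fun x hx => ?_
    rw [max_eq_left, zero_mul]
    rw [mem_closedBall_zero_iff, pi_norm_le_iff_of_nonneg (by positivity)] at hx
    push Not at hx
    obtain ⟨i, hi⟩ := hx
    rw [sub_nonpos, one_le_div (by positivity)]
    calc (k + 1 : ℝ) ≤ (k + 1) ^ 2 := by nlinarith [(Nat.cast_nonneg k : (0 : ℝ) ≤ k)]
      _ ≤ ‖x i‖ ^ 2 := by gcongr
      _ = x i ^ 2 := by simp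
      _ ≤ ∑ i, x i ^ 2 :=
        Finset.single_le_sum (f := fun i => x i ^ 2) (fun _ _ => sq_nonneg _) (Finset.mem_univ i)

theorem cutoffMul_apply (g : C(σ → ℝ, ℝ)) (k : ℕ) (x : σ → ℝ) :
    cutoffMul g k x = max 0 (1 - (∑ i, x i ^ 2) / (k + 1)) * g x := rfl

theorem abs_cutoffMul_le (g : C(σ → ℝ, ℝ)) (k : ℕ) (x : σ → ℝ) : |cutoffMul g k x| ≤ |g x| := by
  have h : 0 ≤ (∑ i, x i ^ 2) / (k + 1 : ℝ) := by positivity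
  rw [cutoffMul_apply, abs_mul, abs_of_nonneg (le_max_left _ _)]
  exact mul_le_of_le_one_left (abs_nonneg _) (max_le zero_le_one (by linarith))

theorem abs_cutoffMul_sub_le (g : C(σ → ℝ, ℝ)) (k : ℕ) (x : σ → ℝ) :
    |cutoffMul g k x - g x| ≤ (k + 1 : ℝ)⁻¹ * ((g x ^ 2 + 1) * ∑ i, x i ^ 2) := by
  have h : 0 ≤ (∑ i, x i ^ 2) / (k + 1 : ℝ) := by positivity
  have h₁ : |max 0 (1 - (∑ i, x i ^ 2) / (k + 1 : ℝ)) - 1| ≤ (∑ i, x i ^ 2) / (k + 1 : ℝ) := by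
    rw [abs_le]
    refine ⟨?_, ?_⟩
    · linarith [le_max_right 0 (1 - (∑ i, x i ^ 2) / (k + 1 : ℝ))]
    · linarith [max_le zero_le_one (sub_le_self 1 h)]
  have h₂ : |g x| ≤ g x ^ 2 + 1 := by nlinarith [sq_abs (g x), sq_nonneg (|g x| - 1)]
  calc |cutoffMul g k x - g x| = |max 0 (1 - (∑ i, x i ^ 2) / (k + 1 : ℝ)) - 1| * |g x| := by
        rw [cutoffMul_apply, ← abs_mul]
        ring_nf
    _ ≤ (∑ i, x i ^ 2) / (k + 1 : ℝ) * (g x ^ 2 + 1) := by gcongr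
    _ = _ := by ring

theorem tendsto_cutoffMul (g : C(σ → ℝ, ℝ)) (x : σ → ℝ) :
    Tendsto (fun k => cutoffMul g k x) atTop (𝓝 (g x)) := by
  rw [tendsto_iff_dist_tendsto_zero]
  refine squeeze_zero (fun _ => dist_nonneg) (fun k => abs_cutoffMul_sub_le g k x) ?_
  have h : Tendsto (fun k : ℕ => (k + 1 : ℝ)⁻¹) atTop (𝓝 0) := by
    simpa using tendsto_one_div_add_atTop_nhds_zero_nat (𝕜 := ℝ)
  simpa using h.mul_const _

theorem tendsto_map_cutoffMul {S : Set (σ → ℝ)} {L : MvPolynomial σ ℝ →ₗ[ℝ] ℝ}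
    {Λ : C_c(σ → ℝ, ℝ) →ₚ[ℝ] ℝ} (h : ∀ (p : MvPolynomial σ ℝ) (f : C_c(σ → ℝ, ℝ)),
      (∀ x ∈ S, f x ≤ eval x p) → Λ f ≤ L p) (p : MvPolynomial σ ℝ) :
    Tendsto (fun k => Λ (cutoffMul (evalContinuousMap p) k)) atTop (𝓝 (L p)) := by
  let q : MvPolynomial σ ℝ := (p ^ 2 + 1) * ∑ i, X i ^ 2
  have hq : ∀ (k : ℕ) (x : σ → ℝ), |cutoffMul (evalContinuousMap p) k x - eval x p| ≤
      eval x ((k + 1 : ℝ)⁻¹ • q) := fun k x => by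
    simpa [q, smul_eval, evalContinuousMap_apply] using
      abs_cutoffMul_sub_le (evalContinuousMap p) k x
  rw [tendsto_iff_dist_tendsto_zero]
  refine squeeze_zero (fun _ => dist_nonneg) (g := fun k : ℕ => (k + 1 : ℝ)⁻¹ * L q)
    (fun k => ?_) ?_
  · rw [Real.dist_eq, abs_le]
    have h₁ := h (p + (k + 1 : ℝ)⁻¹ • q) (cutoffMul (evalContinuousMap p) k) fun x _ => by
      have := le_of_abs_le (hq k x)
      rw [map_add]
      linarith
    have h₂ := h (-p + (k + 1 : ℝ)⁻¹ • q) (-cutoffMul (evalContinuousMap p) k) fun x _ => by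
      have := neg_le_of_abs_le (hq k x)
      rw [map_add, map_neg, CompactlySupportedContinuousMap.coe_neg, Pi.neg_apply]
      linarith
    simp only [map_add, map_neg, map_smul, smul_eq_mul] at h₁ h₂
    constructor <;> linarith
  · have h : Tendsto (fun k : ℕ => (k + 1 : ℝ)⁻¹) atTop (𝓝 0) := by
      simpa using tendsto_one_div_add_atTop_nhds_zero_nat (𝕜 := ℝ)
    simpa using h.mul_const (L q)

/-- **Haviland's theorem**: a linear functional on polynomials which is nonnegative on polynomials
nonnegative on `S` is integration against a measure concentrated on `closure S`. -/
theorem haviland {S : Set (σ → ℝ)} (hS : S.Nonempty) (L : MvPolynomial σ ℝ →ₗ[ℝ] ℝ)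
    (hL : ∀ p, (∀ x ∈ S, 0 ≤ eval x p) → 0 ≤ L p) :
    ∃ μ : Measure (σ → ℝ), μ (closure S)ᶜ = 0 ∧
      ∀ p : MvPolynomial σ ℝ, Integrable (fun x => eval x p) μ ∧ ∫ x, eval x p ∂μ = L p := by
  obtain ⟨Λ, hΛ⟩ := exists_positiveLinearMap_le_of_nonneg S L hL
  let μ := RealRMK.rieszMeasure Λ
  have hμ : ∀ f : C_c(σ → ℝ, ℝ), ∫ x, f x ∂μ = Λ f := RealRMK.integral_rieszMeasure Λ
  have hint : ∀ f : C_c(σ → ℝ, ℝ), Integrable f μ := fun f =>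
    f.continuous.integrable_of_hasCompactSupport f.hasCompactSupport
  have hpos : ∀ p : MvPolynomial σ ℝ, (∀ x, 0 ≤ eval x p) → Integrable (fun x => eval x p) μ := by
    intro p hp
    refine ⟨(MvPolynomial.continuous_eval p).aestronglyMeasurable, ?_⟩
    rw [hasFiniteIntegral_iff_ofReal (ae_of_all _ hp)]
    have hlim : ∀ x, liminf (fun k => ENNReal.ofReal (cutoffMul (evalContinuousMap p) k x)) atTop =
        ENNReal.ofReal (eval x p) := fun x =>
      ((ENNReal.continuous_ofReal.tendsto _).comp (tendsto_cutoffMul _ x)).liminf_eq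
    have hle : ∀ k, ∫⁻ x, ENNReal.ofReal (cutoffMul (evalContinuousMap p) k x) ∂μ ≤
        ENNReal.ofReal (L p) := fun k => by
      rw [← ofReal_integral_eq_lintegral_ofReal (hint _)
        (ae_of_all _ fun x => mul_nonneg (le_max_left _ _) (hp x)), hμ]
      refine ENNReal.ofReal_le_ofReal (hΛ _ _ fun x _ => ?_)
      have h := abs_cutoffMul_le (evalContinuousMap p) k x
      rw [evalContinuousMap_apply, abs_of_nonneg (hp x)] at h
      exact le_of_abs_le h
    calc ∫⁻ x, ENNReal.ofReal (eval x p) ∂μ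
        = ∫⁻ x, liminf (fun k => ENNReal.ofReal (cutoffMul (evalContinuousMap p) k x)) atTop ∂μ :=
          by simp_rw [hlim]
      _ ≤ liminf (fun k => ∫⁻ x, ENNReal.ofReal (cutoffMul (evalContinuousMap p) k x) ∂μ) atTop :=
          lintegral_liminf_le fun k =>
            ENNReal.measurable_ofReal.comp (cutoffMul (evalContinuousMap p) k).continuous.measurable
      _ ≤ liminf (fun _ : ℕ => ENNReal.ofReal (L p)) atTop :=
          liminf_le_liminf (Eventually.of_forall hle)
      _ = ENNReal.ofReal (L p) := liminf_const _
      _ < ⊤ := ENNReal.ofReal_lt_top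
  have hpoly : ∀ p : MvPolynomial σ ℝ, Integrable (fun x => eval x p) μ := fun p => by
    refine (hpos (p ^ 2 + 1) fun x => by simp; positivity).mono'
      (MvPolynomial.continuous_eval p).aestronglyMeasurable (ae_of_all _ fun x => ?_)
    simp only [map_add, map_pow, map_one, Real.norm_eq_abs]
    nlinarith [sq_abs (eval x p), sq_nonneg (|eval x p| - 1)]
  refine ⟨μ, ?_, fun p => ⟨hpoly p, ?_⟩⟩
  · let d : C(σ → ℝ, ℝ) := ⟨fun x => Metric.infDist x S, Metric.continuous_infDist_pt S⟩
    have hd : ∀ k, ∀ᵐ x ∂μ, cutoffMul d k x = 0 := fun k => by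
      have hnonneg : ∀ x, 0 ≤ cutoffMul d k x := fun x =>
        mul_nonneg (le_max_left _ _) Metric.infDist_nonneg
      refine (integral_eq_zero_iff_of_nonneg hnonneg (hint _)).1 (le_antisymm ?_
        (integral_nonneg hnonneg))
      rw [hμ]
      refine (hΛ 0 _ fun x hx => ?_).trans_eq (map_zero L)
      simp [cutoffMul_apply, d, Metric.infDist_zero_of_mem hx]
    have hae : ∀ᵐ x ∂μ, x ∈ closure S := by
      filter_upwards [ae_all_iff.2 hd] with x hx
      rw [Metric.mem_closure_iff_infDist_zero hS]
      exact tendsto_nhds_unique (tendsto_cutoffMul d x) (by simp [hx])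
    exact hae
  · refine tendsto_nhds_unique ?_ (tendsto_map_cutoffMul hΛ p)
    simp_rw [← hμ]
    refine tendsto_integral_of_dominated_convergence (fun x => |eval x p|)
      (fun k => (cutoffMul (evalContinuousMap p) k).continuous.aestronglyMeasurable)
      (hpoly p).abs (fun k => ae_of_all _ fun x => abs_cutoffMul_le _ k x)
      (ae_of_all _ fun x => tendsto_cutoffMul _ x)

end Haviland

section Derivatives

theorem pderiv_pow_monomial {σ R : Type*} [CommSemiring R] (i : σ) (k : ℕ) (β : σ →₀ ℕ) (c : R) :
    ((pderiv i).toLinearMap ^ k : Module.End R (MvPolynomial σ R)) (monomial β c) =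
      monomial (β - Finsupp.single i k) (c * ((β i).descFactorial k : R)) := by
  induction k with
  | zero => simp
  | succ k ih =>
    rw [pow_succ', Module.End.mul_apply, ih, Derivation.coeFn_coe,
      pderiv_monomial, tsub_tsub, ← Finsupp.single_add, Finsupp.tsub_apply, Finsupp.single_eq_same,
      Nat.descFactorial_succ, mul_assoc, Nat.cast_mul, mul_comm ((β i - k : ℕ) : R)]

theorem list_prod_pderiv_pow_monomial {σ R : Type*} [CommSemiring R] (α : σ → ℕ) (β : σ →₀ ℕ)
    (c : R) (l : List σ) (hl : l.Nodup) :
    (l.map fun i => ((pderiv i).toLinearMap ^ α i : Module.End R (MvPolynomial σ R))).prod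
        (monomial β c) =
      monomial (β - (l.map fun i => Finsupp.single i (α i)).sum)
        (c * (l.map fun i => ((β i).descFactorial (α i) : R)).prod) := by
  induction l with
  | nil => simp
  | cons i l ih =>
    rw [List.nodup_cons] at hl
    obtain ⟨hi, hl⟩ := hl
    have h0 : ((l.map fun j => Finsupp.single j (α j)).sum : σ →₀ ℕ) i = 0 := by
      clear ih hl
      induction l with
      | nil => simp
      | cons j l ih =>
        simp only [List.mem_cons, not_or] at hi
        simp [ih hi.2, Finsupp.single_eq_of_ne hi.1]
    simp only [List.map_cons, List.prod_cons, List.sum_cons, Module.End.mul_apply]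
    rw [ih hl, pderiv_pow_monomial, Finsupp.tsub_apply, h0, tsub_zero, tsub_tsub,
      add_comm (List.sum _), mul_assoc, mul_comm (List.prod _)]

theorem Dop_monomial (n : ℕ) (α : Fin n → ℕ) (β : Fin n →₀ ℕ) (c : ℝ) :
    Dop n α (monomial β c) = monomial (β - Finsupp.equivFunOnFinite.symm α)
      (c * ∏ i, ((β i).descFactorial (α i) : ℝ)) := by
  rw [Dop, List.ofFn_eq_map, list_prod_pderiv_pow_monomial _ _ _ _ (List.nodup_finRange n),
    ← List.ofFn_eq_map, ← List.ofFn_eq_map, List.prod_ofFn, List.sum_ofFn]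
  congr
  ext i
  simp [Finsupp.single_apply, Finsupp.finsetSum_apply]

theorem Dop_monomial_eq_zero {n : ℕ} {α : Fin n → ℕ} {β : Fin n →₀ ℕ} (h : ¬ α ≤ β) (c : ℝ) :
    Dop n α (monomial β c) = 0 := by
  obtain ⟨i, hi⟩ := not_forall.1 h
  rw [Dop_monomial, Finset.prod_eq_zero (Finset.mem_univ i), mul_zero, monomial_zero]
  rw [Nat.descFactorial_of_lt (not_le.1 hi), Nat.cast_zero]

theorem eval_zero_Dop_monomial (n : ℕ) (α : Fin n → ℕ) (β : Fin n →₀ ℕ) (c : ℝ) :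
    eval 0 (Dop n α (monomial β c)) = if (β : Fin n → ℕ) = α then c * ∏ i, ((α i).factorial : ℝ)
      else 0 := by
  split_ifs with h
  · subst h
    simp [Dop_monomial, Nat.descFactorial_self]
  · by_cases hle : α ≤ β
    · have hne : β - Finsupp.equivFunOnFinite.symm α ≠ 0 := fun h0 =>
        h (le_antisymm (fun i =>
        tsub_eq_zero_iff_le.1 (by simpa using DFunLike.congr_fun h0 i)) hle)
      obtain ⟨i, hi⟩ := Finsupp.ne_iff.1 hne
      rw [Dop_monomial, eval_monomial, Finsupp.prod,
        Finset.prod_eq_zero (Finsupp.mem_support_iff.2 hi), mul_zero]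
      exact zero_pow hi
    · rw [Dop_monomial_eq_zero hle, map_zero]

theorem finite_support_smul_Dop {n : ℕ} (r : (Fin n → ℕ) → ℝ) (p : MvPolynomial (Fin n) ℝ) :
    (Function.support fun α => r α • Dop n α p).Finite := by
  induction p using MvPolynomial.induction_on' with
  | monomial β c =>
    refine (Set.finite_Iic (β : Fin n → ℕ)).subset fun α hα => ?_
    by_contra h
    exact hα (by simp only [Dop_monomial_eq_zero h, smul_zero])
  | add p q hp hq =>
    refine (hp.union hq).subset ?_
    simp only [map_add, smul_add]
    exact Function.support_add _ _

/-- The functional `p ↦ (∑ α, r α • D^α p) 0`. -/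
noncomputable def evalZeroConstCoeff {n : ℕ} (r : (Fin n → ℕ) → ℝ) :
    MvPolynomial (Fin n) ℝ →ₗ[ℝ] ℝ where
  toFun p := eval 0 (∑ᶠ α : Fin n → ℕ, r α • Dop n α p)
  map_add' p q := by
    simp only [map_add, smul_add]
    rw [finsum_add_distrib (finite_support_smul_Dop r p) (finite_support_smul_Dop r q), map_add]
  map_smul' c p := by
    simp only [map_smul, smul_comm _ c, RingHom.id_apply, ← smul_finsum, smul_eval, smul_eq_mul]

theorem evalZeroConstCoeff_monomial {n : ℕ} (r : (Fin n → ℕ) → ℝ) (β : Fin n →₀ ℕ) (c : ℝ) :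
    evalZeroConstCoeff r (monomial β c) = c * (∏ i, ((β i).factorial : ℝ)) * r β := by
  change (eval (0 : Fin n → ℝ)).toAddMonoidHom (∑ᶠ α : Fin n → ℕ, r α • Dop n α _) = _
  rw [AddMonoidHom.map_finsum _ (finite_support_smul_Dop r _), finsum_eq_single _ (β : Fin n → ℕ)]
  · change eval 0 (r β • Dop n β (monomial β c)) = _
    rw [smul_eval, eval_zero_Dop_monomial, if_pos rfl, mul_comm]
  · intro α hα
    change eval 0 (r α • Dop n α (monomial β c)) = 0
    rw [smul_eval, eval_zero_Dop_monomial, if_neg hα.symm, mul_zero]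

end Derivatives

/-- If `0 ∈ S` and the constant-coefficient differential operator `Φ = Σ_α r_α D^α` is an
`S`-nonnegativity preserver, then `(α! · r_α)_α` is a moment sequence of the closure of `S`. -/
theorem moment_sequence_of_nonnegativity_preserving_constant_coefficients
    (n : ℕ) (S : Set (Fin n → ℝ)) (h0 : 0 ∈ S) (r : (Fin n → ℕ) → ℝ)
    (hΦ : ∀ p : MvPolynomial (Fin n) ℝ,
      (∀ x ∈ S, 0 ≤ MvPolynomial.eval x p) →
        ∀ x ∈ S, 0 ≤ MvPolynomial.eval x (∑ᶠ α : Fin n → ℕ, r α • Dop n α p)) :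
    ∃ μ : Measure (Fin n → ℝ),
      μ (closure S)ᶜ = 0 ∧
      (∀ p : MvPolynomial (Fin n) ℝ, Integrable (fun x => MvPolynomial.eval x p) μ) ∧
      ∀ α : Fin n → ℕ,
        ∫ x, (∏ i, x i ^ α i) ∂μ = (∏ i, (Nat.factorial (α i) : ℝ)) * r α := by
  obtain ⟨μ, hμ, h⟩ := haviland ⟨0, h0⟩ (evalZeroConstCoeff r) fun p hp => hΦ p hp 0 h0
  refine ⟨μ, hμ, fun p => (h p).1, fun α => ?_⟩
  have hα := (h (monomial (Finsupp.equivFunOnFinite.symm α) 1)).2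
  rw [evalZeroConstCoeff_monomial] at hα
  simpa [eval_monomial, Finsupp.prod_fintype] using hα
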